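/- Fix positive reals k1,…,k30. In the polynomial ring ℝ[x1,…,x21], the ideal generated by the 21 component polynomials f_1,…,f_21 of the mass action vector field of Net2 equals the ideal generated by the 15 binomials (k2+k3)x12 − k1·x1·x9, (k5+k6)x17 − k4·x2·x10, k3·x12 − k6·x17, (k8+k9)x13 − k7·x2·x3, (k17+k18)x19 − k16·x4·x11, k9·x13 − k18·x19, (k11+k12)x14 − k10·x2·x4, (k14+k15)x18 − k13·x5·x11, k12·x14 − k15·x18, (k20+k21)x15 − k19·x5·x6, (k29+k30)x21 − k28·x7·x11, k21·x15 − k30·x21, (k23+k24)x16 − k22·x5·x7, (k26+k27)x20 − k25·x8·x11, k24·x16 − k27·x20; in particular Net2 has toric steady states for all positive rate constants. -/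

import Mathlib

/-- The `j`-th standard basis vector of `ℕ^21`. -/
def ee (j : Fin 21) : Fin 21 → ℕ := fun i => if i = j then 1 else 0

/-- The 10 motifs `A + B ⇄ C → D + B` of Net2, recorded as tuples `(A, B, C, D)`
(0-based species indices, so `Xⱼ` is index `j - 1`). -/
def motifs2 : Fin 10 → Fin 21 × Fin 21 × Fin 21 × Fin 21 :=
  ![(0, 8, 11, 1),
    (1, 9, 16, 0),
    (2, 1, 12, 3),
    (3, 1, 13, 4),
    (4, 10, 17, 3),
    (3, 10, 18, 2),
    (5, 4, 14, 6),
    (6, 4, 15, 7),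
    (7, 10, 19, 6),
    (6, 10, 20, 5)]

/-- Exponent vector of the source complex of the `i`-th reaction of Net2
(motif `i / 3`; reactions `A+B → C`, `C → A+B`, `C → D+B`). -/
def src2 (i : Fin 30) : Fin 21 → ℕ :=
  let m := motifs2 ⟨i.val / 3, by have := i.isLt; omega⟩
  if i.val % 3 = 0 then ee m.1 + ee m.2.1 else ee m.2.2.1

/-- Exponent vector of the product complex of the `i`-th reaction of Net2. -/
def tgt2 (i : Fin 30) : Fin 21 → ℕ :=
  let m := motifs2 ⟨i.val / 3, by have := i.isLt; omega⟩
  if i.val % 3 = 0 then ee m.2.2.1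
  else if i.val % 3 = 1 then ee m.1 + ee m.2.1
  else ee m.2.2.2 + ee m.2.1

open MvPolynomial

/-- The `j`-th component of the mass action vector field of Net2, as a polynomial in
`ℝ[x₁,…,x21]`. -/
noncomputable def massActionPoly2 (k : Fin 30 → ℝ) (j : Fin 21) :
    MvPolynomial (Fin 21) ℝ :=
  ∑ i : Fin 30,
    C (k i * ((tgt2 i j : ℝ) - (src2 i j : ℝ))) * ∏ l : Fin 21, X l ^ src2 i l

lemma prod_ee (a : Fin 21) : (∏ l : Fin 21, (X l : MvPolynomial (Fin 21) ℝ) ^ ee a l) = X a := by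
  rw [Finset.prod_eq_single a] <;> simp +contextual [ee]

lemma prod_ee2 (a b : Fin 21) :
    (∏ l : Fin 21, (X l : MvPolynomial (Fin 21) ℝ) ^ (ee a + ee b) l) = X a * X b := by
  simp only [Pi.add_apply, pow_add, Finset.prod_mul_distrib, prod_ee]

/-- kinetic index -/
def ix (m : Fin 10) (r : Fin 3) : Fin 30 := ⟨3 * m.val + r.val, by omega⟩

noncomputable def gg (k : Fin 30 → ℝ) (m : Fin 10) : MvPolynomial (Fin 21) ℝ :=
  C (k (ix m 0)) * (X (motifs2 m).1 * X (motifs2 m).2.1)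
    - C (k (ix m 1) + k (ix m 2)) * X (motifs2 m).2.2.1

noncomputable def pp (k : Fin 30 → ℝ) (m : Fin 10) : MvPolynomial (Fin 21) ℝ :=
  C (k (ix m 2)) * X (motifs2 m).2.2.1

def ei (a j : Fin 21) : ℤ := if j = a then 1 else 0

lemma sum_ix {M : Type*} [AddCommMonoid M] (f : Fin 30 → M) :
    ∑ i, f i = ∑ m : Fin 10, (f (ix m 0) + f (ix m 1) + f (ix m 2)) := by
  have h : ∑ i, f i = ∑ x : Fin 10 × Fin 3, f (finProdFinEquiv x) :=
    (Equiv.sum_comp (finProdFinEquiv (m := 10) (n := 3)) f).symm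
  rw [h, Fintype.sum_prod_type]
  refine Finset.sum_congr rfl fun m _ => ?_
  rw [Fin.sum_univ_three]
  have e : ∀ r : Fin 3, (finProdFinEquiv (m, r) : Fin 30) = ix m r := by
    intro r; apply Fin.ext; simp [ix, finProdFinEquiv]; omega
  rw [e, e, e]

lemma massAction_eq (k : Fin 30 → ℝ) (j : Fin 21) :
    massActionPoly2 k j = ∑ m : Fin 10,
      (((ei (motifs2 m).2.2.1 j - ei (motifs2 m).1 j - ei (motifs2 m).2.1 j : ℤ) :
          MvPolynomial (Fin 21) ℝ) * gg k m
        + ((ei (motifs2 m).2.2.2 j - ei (motifs2 m).1 j : ℤ) :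
          MvPolynomial (Fin 21) ℝ) * pp k m) := by
  unfold massActionPoly2
  rw [sum_ix]
  refine Finset.sum_congr rfl fun m _ => ?_
  have q : ∀ r : Fin 3, (ix m r).val / 3 = m.val := by intro r; simp [ix]; omega
  have q0 : (ix m 0).val % 3 = 0 := by simp [ix]
  have q1 : (ix m 1).val % 3 = 1 := by simp [ix]
  have q2 : (ix m 2).val % 3 = 2 := by simp [ix]
  have s0 : src2 (ix m 0) = ee (motifs2 m).1 + ee (motifs2 m).2.1 := by
    simp [src2, q, q0]
  have s1 : src2 (ix m 1) = ee (motifs2 m).2.2.1 := by simp [src2, q, q1]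
  have s2 : src2 (ix m 2) = ee (motifs2 m).2.2.1 := by simp [src2, q, q2]
  have t0 : tgt2 (ix m 0) = ee (motifs2 m).2.2.1 := by simp [tgt2, q, q0]
  have t1 : tgt2 (ix m 1) = ee (motifs2 m).1 + ee (motifs2 m).2.1 := by
    simp [tgt2, q, q1]
  have t2 : tgt2 (ix m 2) = ee (motifs2 m).2.2.2 + ee (motifs2 m).2.1 := by
    simp [tgt2, q, q2]
  have c : ∀ a, (ee a j : MvPolynomial (Fin 21) ℝ) = ((ei a j : ℤ) : MvPolynomial (Fin 21) ℝ) := by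
    intro a; unfold ee ei; split_ifs <;> simp
  simp only [s0, s1, s2, prod_ee, prod_ee2]
  simp only [t0, t1, t2, gg, pp, Pi.add_apply, Nat.cast_add,
    C_mul, C_add, C_sub, map_natCast, c]
  push_cast
  ring

set_option maxHeartbeats 4000000 in
lemma abs_iff {R : Type*} [CommRing R] (G P : Fin 10 → R) :
    (∀ j : Fin 21, ∑ m : Fin 10,
      (((ei (motifs2 m).2.2.1 j - ei (motifs2 m).1 j - ei (motifs2 m).2.1 j : ℤ) : R) * G m
        + ((ei (motifs2 m).2.2.2 j - ei (motifs2 m).1 j : ℤ) : R) * P m) = 0) ↔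
    ((∀ m, G m = 0) ∧ P 0 - P 1 = 0 ∧ P 2 - P 5 = 0 ∧ P 3 - P 4 = 0 ∧ P 6 - P 9 = 0 ∧
      P 7 - P 8 = 0) := by
  constructor
  · intro h
    have g : ∀ m, G m = 0 := by
      intro m
      have := h (motifs2 m).2.2.1
      fin_cases m <;> simpa [Fin.sum_univ_succ, motifs2, ei] using this
    simp only [g, mul_zero, zero_add] at h
    refine ⟨g, ?_, ?_, ?_, ?_, ?_⟩
    · have := h 1
      simp [Fin.sum_univ_succ, motifs2, ei] at this
      linear_combination this
    · have := h 2
      simp [Fin.sum_univ_succ, motifs2, ei] at this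
      linear_combination -this
    · have := h 4
      simp [Fin.sum_univ_succ, motifs2, ei] at this
      linear_combination this
    · have := h 5
      simp [Fin.sum_univ_succ, motifs2, ei] at this
      linear_combination -this
    · have := h 7
      simp [Fin.sum_univ_succ, motifs2, ei] at this
      linear_combination this
  · rintro ⟨g, h1, h2, h3, h4, h5⟩ j
    rw [sub_eq_zero] at h1 h2 h3 h4 h5
    simp only [g, mul_zero, zero_add]
    fin_cases j <;> simp [Fin.sum_univ_succ, motifs2, ei, h1, h2, h3, h4, h5]

lemma mem_iff (k : Fin 30 → ℝ) (I : Ideal (MvPolynomial (Fin 21) ℝ)) :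
    (∀ j, massActionPoly2 k j ∈ I) ↔ ((∀ m, gg k m ∈ I) ∧ pp k 0 - pp k 1 ∈ I ∧
      pp k 2 - pp k 5 ∈ I ∧ pp k 3 - pp k 4 ∈ I ∧ pp k 6 - pp k 9 ∈ I ∧ pp k 7 - pp k 8 ∈ I) := by
  simp only [← Ideal.Quotient.eq_zero_iff_mem, massAction_eq, map_sum, map_add, map_mul, map_sub,
    map_intCast]
  generalize hG : (fun m => (Ideal.Quotient.mk I) (gg k m)) = G
  generalize hP : (fun m => (Ideal.Quotient.mk I) (pp k m)) = P
  have hG' : ∀ m, (Ideal.Quotient.mk I) (gg k m) = G m := fun m => by rw [← hG]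
  have hP' : ∀ m, (Ideal.Quotient.mk I) (pp k m) = P m := fun m => by rw [← hP]
  simp only [hG', hP']
  exact abs_iff G P

/-- For every choice of positive rate constants, the steady state ideal of Net2 (the ideal
generated by the 21 components of the mass action vector field) equals the ideal generated
by the 15 binomials; in particular Net2 has toric steady states.
(Rate constant `kⱼ` of the paper is `k (j-1)` here, species `Xⱼ` is the variable `X (j-1)`.) -/
theorem net2_steady_state_ideal_is_binomial (k : Fin 30 → ℝ) (hk : ∀ i, 0 < k i) :
    Ideal.span (Set.range (massActionPoly2 k)) =
      Ideal.span
       ({C (k 1 + k 2) * X 11 - C (k 0) * (X 0 * X 8),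
        C (k 4 + k 5) * X 16 - C (k 3) * (X 1 * X 9),
        C (k 2) * X 11 - C (k 5) * X 16,
        C (k 7 + k 8) * X 12 - C (k 6) * (X 1 * X 2),
        C (k 16 + k 17) * X 18 - C (k 15) * (X 3 * X 10),
        C (k 8) * X 12 - C (k 17) * X 18,
        C (k 10 + k 11) * X 13 - C (k 9) * (X 1 * X 3),
        C (k 13 + k 14) * X 17 - C (k 12) * (X 4 * X 10),
        C (k 11) * X 13 - C (k 14) * X 17,
        C (k 19 + k 20) * X 14 - C (k 18) * (X 4 * X 5),
        C (k 28 + k 29) * X 20 - C (k 27) * (X 6 * X 10),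
        C (k 20) * X 14 - C (k 29) * X 20,
        C (k 22 + k 23) * X 15 - C (k 21) * (X 4 * X 6),
        C (k 25 + k 26) * X 19 - C (k 24) * (X 7 * X 10),
        C (k 23) * X 15 - C (k 26) * X 19} : Set (MvPolynomial (Fin 21) ℝ)) := by
  have key : ∀ I : Ideal (MvPolynomial (Fin 21) ℝ),
      Ideal.span (Set.range (massActionPoly2 k)) ≤ I ↔ Ideal.span
       ({C (k 1 + k 2) * X 11 - C (k 0) * (X 0 * X 8),
        C (k 4 + k 5) * X 16 - C (k 3) * (X 1 * X 9),
        C (k 2) * X 11 - C (k 5) * X 16,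
        C (k 7 + k 8) * X 12 - C (k 6) * (X 1 * X 2),
        C (k 16 + k 17) * X 18 - C (k 15) * (X 3 * X 10),
        C (k 8) * X 12 - C (k 17) * X 18,
        C (k 10 + k 11) * X 13 - C (k 9) * (X 1 * X 3),
        C (k 13 + k 14) * X 17 - C (k 12) * (X 4 * X 10),
        C (k 11) * X 13 - C (k 14) * X 17,
        C (k 19 + k 20) * X 14 - C (k 18) * (X 4 * X 5),
        C (k 28 + k 29) * X 20 - C (k 27) * (X 6 * X 10),
        C (k 20) * X 14 - C (k 29) * X 20,
        C (k 22 + k 23) * X 15 - C (k 21) * (X 4 * X 6),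
        C (k 25 + k 26) * X 19 - C (k 24) * (X 7 * X 10),
        C (k 23) * X 15 - C (k 26) * X 19} : Set (MvPolynomial (Fin 21) ℝ)) ≤ I := by
    intro I
    rw [Ideal.span_le, Set.range_subset_iff]
    simp only [SetLike.mem_coe]
    rw [mem_iff]
    symm
    rw [Ideal.span_le]
    simp only [Set.insert_subset_iff, Set.singleton_subset_iff, SetLike.mem_coe]
    have e : ∀ m, gg k m ∈ I ↔ C (k (ix m 1) + k (ix m 2)) * X (motifs2 m).2.2.1 -
        C (k (ix m 0)) * (X (motifs2 m).1 * X (motifs2 m).2.1) ∈ I := by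
      intro m
      rw [← neg_mem_iff, gg, neg_sub]
    simp only [e, pp, Fin.forall_fin_succ, IsEmpty.forall_iff, and_true]
    have c1 : (X 1 * X 2 : MvPolynomial (Fin 21) ℝ) = X 2 * X 1 := mul_comm _ _
    have c2 : (X 1 * X 3 : MvPolynomial (Fin 21) ℝ) = X 3 * X 1 := mul_comm _ _
    have c3 : (X 4 * X 5 : MvPolynomial (Fin 21) ℝ) = X 5 * X 4 := mul_comm _ _
    have c4 : (X 4 * X 6 : MvPolynomial (Fin 21) ℝ) = X 6 * X 4 := mul_comm _ _
    rw [c1, c2, c3, c4]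
    constructor
    · rintro ⟨a1, a2, a3, a4, a5, a6, a7, a8, a9, a10, a11, a12, a13, a14, a15⟩
      exact ⟨⟨a1, a2, a4, a7, a8, a5, a10, a13, a14, a11⟩, a3, a6, a9, a12, a15⟩
    · rintro ⟨⟨a1, a2, a4, a7, a8, a5, a10, a13, a14, a11⟩, a3, a6, a9, a12, a15⟩
      exact ⟨a1, a2, a3, a4, a5, a6, a7, a8, a9, a10, a11, a12, a13, a14, a15⟩
  exact le_antisymm ((key _).2 le_rfl) ((key _).1 le_rfl)
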